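/- For every ε > 0 and every positive integer m there exists a real-analytic map θ : ℝ → ℝ such that: θ − id is (1/m)-periodic, θ(0) = 0, θ(1/(2m)) = 2, θ([0, 1/(2m)]) = [0, 2], θ is ε-crooked on [0, 1/(2m)], θ(1/m) = 1/m, θ([1/(2m), 1/m]) = [1/m, 2], and θ is ε-crooked on [1/(2m), 1/m]. -/

import Mathlib

/-- `g` is `ε`-crooked on the set `I`: for any `a < b` in `I` there are `c, d` with
`a < c < d < b` such that `|g d − g a| < ε` and `|g c − g b| < ε`. -/
def CrookedOn (ε : ℝ) (g : ℝ → ℝ) (I : Set ℝ) : Prop :=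
  ∀ a ∈ I, ∀ b ∈ I, a < b →
    ∃ c d : ℝ, a < c ∧ c < d ∧ d < b ∧ |g d - g a| < ε ∧ |g c - g b| < ε

open Set Filter Topology

lemma crooked_close {ε : ℝ} {g : ℝ → ℝ} (hg : Continuous g) {a b : ℝ} (hab : a < b)
    (h : |g a - g b| < ε) :
    ∃ c d : ℝ, a < c ∧ c < d ∧ d < b ∧ |g d - g a| < ε ∧ |g c - g b| < ε := by
  have hε : 0 < ε := lt_of_le_of_lt (abs_nonneg _) h
  have h1 : ∀ᶠ x in 𝓝 a, |g x - g a| < ε := by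
    have : Continuous fun x => |g x - g a| := by fun_prop
    exact this.continuousAt.eventually (gt_mem_nhds (by simpa using hε))
  have h2 : ∀ᶠ x in 𝓝 a, |g x - g b| < ε := by
    have : Continuous fun x => |g x - g b| := by fun_prop
    exact this.continuousAt.eventually (gt_mem_nhds h)
  obtain ⟨r, hr, hr'⟩ := Metric.eventually_nhds_iff.1 (h1.and h2)
  set s := min r (b - a) with hs
  have hs0 : 0 < s := lt_min hr (by linarith)
  have hsr : s ≤ r := min_le_left _ _
  have hsb : s ≤ b - a := min_le_right _ _
  refine ⟨a + s / 3, a + s / 2, by linarith, by linarith, by linarith, ?_, ?_⟩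
  · refine (hr' ?_).1
    rw [Real.dist_eq, show a + s / 2 - a = s / 2 by ring, abs_of_pos (by linarith)]
    linarith
  · refine (hr' ?_).2
    rw [Real.dist_eq, show a + s / 3 - a = s / 3 by ring, abs_of_pos (by linarith)]
    linarith

lemma crooked_approx {ε ρ : ℝ} {f g : ℝ → ℝ} {p q : ℝ} (hg : CrookedOn ε g (Icc p q))
    (h : ∀ x ∈ Icc p q, |f x - g x| ≤ ρ) : CrookedOn (ε + 2 * ρ) f (Icc p q) := by
  intro a ha b hb hab
  obtain ⟨c, d, h1, h2, h3, h4, h5⟩ := hg a ha b hb hab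
  have hc := h c ⟨by linarith [ha.1], by linarith [hb.2]⟩
  have hd := h d ⟨by linarith [ha.1], by linarith [hb.2]⟩
  have ha' := h a ha
  have hb' := h b hb
  refine ⟨c, d, h1, h2, h3, ?_, ?_⟩ <;> rw [abs_lt] at * <;> rw [abs_le] at * <;>
    constructor <;> linarith [hc.1, hc.2, hd.1, hd.2, ha'.1, ha'.2, hb'.1, hb'.2, h4.1, h4.2, h5.1, h5.2]

lemma crooked_congr {ε : ℝ} {f g : ℝ → ℝ} {p q : ℝ} (hg : CrookedOn ε g (Icc p q))
    (h : ∀ x ∈ Icc p q, f x = g x) : CrookedOn ε f (Icc p q) := by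
  have := crooked_approx (ρ := 0) (f := f) hg (fun x hx => by simp [h x hx])
  simpa using this

lemma crooked_const_sub {ε : ℝ} {g : ℝ → ℝ} {I : Set ℝ} (hg : CrookedOn ε g I) (k : ℝ) :
    CrookedOn ε (fun t => k - g t) I := by
  intro a ha b hb hab
  obtain ⟨c, d, h1, h2, h3, h4, h5⟩ := hg a ha b hb hab
  refine ⟨c, d, h1, h2, h3, ?_, ?_⟩
  · rw [abs_sub_comm] at h4; simpa using h4
  · rw [abs_sub_comm] at h5; simpa using h5

lemma crooked_const_add {ε : ℝ} {g : ℝ → ℝ} {I : Set ℝ} (hg : CrookedOn ε g I) (k : ℝ) :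
    CrookedOn ε (fun t => k + g t) I := by
  have := crooked_const_sub (crooked_const_sub hg 0) k
  simpa using this

lemma crooked_affine {ε : ℝ} {g : ℝ → ℝ} {p q p' q' α β : ℝ} (hα : 0 < α)
    (hp : α * p + β = p') (hq : α * q + β = q')
    (hg : CrookedOn ε g (Icc p' q')) :
    CrookedOn ε (fun t => g (α * t + β)) (Icc p q) := by
  subst hp hq
  intro a ha b hb hab
  have mono : ∀ {x y : ℝ}, x ≤ y → α * x + β ≤ α * y + β := fun h => by
    have := mul_le_mul_of_nonneg_left h hα.le; linarith
  obtain ⟨c, d, h1, h2, h3, h4, h5⟩ := hg (α * a + β) ⟨mono ha.1, mono ha.2⟩ (α * b + β)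
    ⟨mono hb.1, mono hb.2⟩ (by have := mul_lt_mul_of_pos_left hab hα; linarith)
  have e : ∀ x, α * ((x - β) / α) + β = x := fun x => by field_simp; ring
  refine ⟨(c - β) / α, (d - β) / α, ?_, ?_, ?_, ?_, ?_⟩
  · rw [lt_div_iff₀ hα]; linarith
  · gcongr
  · rw [div_lt_iff₀ hα]; linarith
  · simpa only [e] using h4
  · simpa only [e] using h5

lemma ivt {g : ℝ → ℝ} (hg : Continuous g) {p q y : ℝ} (hpq : p ≤ q) (h1 : g p ≤ y)
    (h2 : y ≤ g q) : ∃ t, p ≤ t ∧ t ≤ q ∧ g t = y := by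
  obtain ⟨t, ht, e⟩ := intermediate_value_Icc hpq hg.continuousOn ⟨h1, h2⟩
  exact ⟨t, ht.1, ht.2, e⟩

lemma ivt' {g : ℝ → ℝ} (hg : Continuous g) {p q y : ℝ} (hpq : p ≤ q) (h1 : y ≤ g p)
    (h2 : g q ≤ y) : ∃ t, p ≤ t ∧ t ≤ q ∧ g t = y := by
  obtain ⟨t, ht, e⟩ := intermediate_value_Icc' hpq hg.continuousOn ⟨h2, h1⟩
  exact ⟨t, ht.1, ht.2, e⟩

/-- if `g` is crooked on `[q,b]`, and `g b < g a ≤ g q`, we find the witnesses in `(q,b)`. -/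
lemma crooked_down {ε : ℝ} (hε : 0 < ε) {g : ℝ → ℝ} (hg : Continuous g) {q a b r : ℝ}
    (h : CrookedOn ε g (Icc q r)) (haq : a < q) (hqb : q < b) (hbr : b ≤ r)
    (h1 : g b + ε ≤ g a) (h2 : g a ≤ g q) :
    ∃ c d : ℝ, a < c ∧ c < d ∧ d < b ∧ |g d - g a| < ε ∧ |g c - g b| < ε := by
  obtain ⟨c, d, i1, i2, i3, i4, i5⟩ := h q ⟨le_rfl, by linarith⟩ b ⟨hqb.le, hbr⟩ hqb
  have j4 := abs_lt.1 i4
  have j5 := abs_lt.1 i5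
  by_cases hd : g d ≤ g a
  · exact ⟨c, d, by linarith, i2, i3, abs_lt.2 ⟨by linarith, by linarith⟩, i5⟩
  · push Not at hd
    obtain ⟨t, t1, t2, t3⟩ := ivt hg i2.le (y := g a) (by linarith) hd.le
    have : c ≠ t := by rintro rfl; linarith
    exact ⟨c, t, by linarith, lt_of_le_of_ne t1 this, by linarith, by simpa [t3] using hε, i5⟩

lemma crooked_max {ε : ℝ} (hε : 0 < ε) {g : ℝ → ℝ} (hg : Continuous g) {p q r : ℝ}
    (h1 : CrookedOn ε g (Icc p q)) (h2 : CrookedOn ε g (Icc q r))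
    (hm : ∀ t ∈ Icc p r, g t ≤ g q) : CrookedOn ε g (Icc p r) := by
  intro a ha b hb hab
  by_cases hbq : b ≤ q
  · exact h1 a ⟨ha.1, by linarith⟩ b ⟨hb.1, hbq⟩ hab
  by_cases haq : q ≤ a
  · exact h2 a ⟨haq, ha.2⟩ b ⟨by linarith, hb.2⟩ hab
  push Not at hbq haq
  by_cases hc : |g a - g b| < ε
  · exact crooked_close hg hab hc
  push Not at hc
  rcases le_abs.1 hc with hc | hc
  · exact crooked_down hε hg h2 haq hbq hb.2 (by linarith) (hm a ha)
  · obtain ⟨c, d, i1, i2, i3, i4, i5⟩ := h1 a ⟨ha.1, haq.le⟩ q ⟨by linarith [ha.1], le_rfl⟩ haq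
    have j4 := abs_lt.1 i4
    have j5 := abs_lt.1 i5
    have := hm b hb
    by_cases hd : g c ≤ g b
    · exact ⟨c, d, i1, i2, by linarith, i4, abs_lt.2 ⟨by linarith, by linarith⟩⟩
    · push Not at hd
      obtain ⟨t, t1, t2, t3⟩ := ivt hg i1.le (y := g b) (by linarith) hd.le
      have : a ≠ t := by rintro rfl; linarith
      exact ⟨t, d, lt_of_le_of_ne t1 this, by linarith, by linarith, i4, by simpa [t3] using hε⟩

lemma crooked_min {ε : ℝ} (hε : 0 < ε) {g : ℝ → ℝ} (hg : Continuous g) {p q r : ℝ}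
    (h1 : CrookedOn ε g (Icc p q)) (h2 : CrookedOn ε g (Icc q r))
    (hm : ∀ t ∈ Icc p r, g q ≤ g t) : CrookedOn ε g (Icc p r) := by
  have := crooked_max hε (g := fun t => 0 - g t) (by fun_prop) (crooked_const_sub h1 0)
    (crooked_const_sub h2 0) (fun t ht => by linarith [hm t ht])
  simpa using crooked_const_sub this 0

lemma crooked_step {ε η k : ℝ} (hη : 0 < η) (hηε : 2 * η < ε) {f : ℝ → ℝ} (hf : Continuous f)
    (c1 : CrookedOn ε f (Icc 0 1)) (c2 : CrookedOn ε f (Icc 1 2)) (c3 : CrookedOn ε f (Icc 2 3))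
    (f1 : f 1 = k) (f2 : f 2 = η) (r1 : ∀ t ∈ Icc (0 : ℝ) 1, 0 ≤ f t ∧ f t ≤ k)
    (r2 : ∀ t ∈ Icc (1 : ℝ) 2, η ≤ f t ∧ f t ≤ k)
    (r3 : ∀ t ∈ Icc (2 : ℝ) 3, η ≤ f t ∧ f t ≤ k + η) : CrookedOn ε f (Icc 0 3) := by
  have hε : 0 < ε := by linarith
  have c12 : CrookedOn ε f (Icc 0 2) := crooked_max hε hf c1 c2 (by
    intro t ht
    rw [f1]
    rcases le_total t 1 with h | h
    · exact (r1 t ⟨ht.1, h⟩).2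
    · exact (r2 t ⟨h, ht.2⟩).2)
  have c23 : CrookedOn ε f (Icc 1 3) := crooked_min hε hf c2 c3 (by
    intro t ht
    rw [f2]
    rcases le_total t 2 with h | h
    · exact (r2 t ⟨ht.1, h⟩).1
    · exact (r3 t ⟨h, ht.2⟩).1)
  intro a ha b hb hab
  by_cases hbq : b ≤ 2
  · exact c12 a ⟨ha.1, by linarith⟩ b ⟨hb.1, hbq⟩ hab
  by_cases haq : 1 ≤ a
  · exact c23 a ⟨haq, ha.2⟩ b ⟨by linarith, hb.2⟩ hab
  push Not at hbq haq
  by_cases hc : |f a - f b| < ε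
  · exact crooked_close hf hab hc
  push Not at hc
  obtain ⟨ra, ra'⟩ := r1 a ⟨ha.1, haq.le⟩
  obtain ⟨rb, rb'⟩ := r3 b ⟨hbq.le, hb.2⟩
  have rk := (r2 1 ⟨by norm_num, by norm_num⟩).1
  rcases le_abs.1 hc with hc | hc
  · exact crooked_down hε hf c23 haq (by linarith) hb.2 (by linarith) (by rw [f1]; exact ra')
  · obtain ⟨u, hu1, hu2, hu3, hu4⟩ : ∃ u, u ≤ f b ∧ f b - η ≤ u ∧ u ≤ k ∧ (u = f b ∨ u = k) := by
      rcases le_total (f b) k with h | h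
      · exact ⟨f b, by linarith, by linarith, h, Or.inl rfl⟩
      · exact ⟨k, by linarith, by linarith, le_rfl, Or.inr rfl⟩
    obtain ⟨v, hv1, hv2, hv3, hv4⟩ : ∃ v, f a ≤ v ∧ v ≤ f a + η ∧ η ≤ v ∧ (v = f a ∨ v = η) := by
      rcases le_total (f a) η with h | h
      · exact ⟨η, by linarith, by linarith, le_rfl, Or.inr rfl⟩
      · exact ⟨f a, by linarith, by linarith, h, Or.inl rfl⟩
    have huv : v < u ∨ (u = k ∧ v = η ∧ u ≤ v) ∨ (u = k ∧ v = f a ∧ u ≤ v) := by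
      by_contra hcon
      push Not at hcon
      obtain ⟨x1, x2, x3⟩ := hcon
      rcases hu4 with h | h <;> rcases hv4 with h' | h'
      · linarith
      · linarith
      · linarith [x3 h h']
      · linarith [x2 h h']
    have huv : v < u := by
      rcases huv with h | ⟨h, h', h''⟩ | ⟨h, h', h''⟩
      · exact h
      · linarith
      · linarith
    obtain ⟨c, i1, i2, i3⟩ := ivt' hf (p := 1) (q := 2) (y := u) (by norm_num) (by rw [f1]; exact hu3)
      (by rw [f2]; linarith)
    obtain ⟨d, j1, j2, j3⟩ := ivt' hf (p := c) (q := 2) (y := v) i2 (by rw [i3]; exact huv.le)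
      (by rw [f2]; linarith)
    have : c ≠ d := by rintro rfl; linarith
    refine ⟨c, d, by linarith, lt_of_le_of_ne j1 this, by linarith, ?_, ?_⟩
    · rw [j3, abs_lt]; constructor <;> linarith
    · rw [i3, abs_lt]; constructor <;> linarith

def QPath (ε L : ℝ) : Prop := ∃ g : ℝ → ℝ, Continuous g ∧ (∀ t ≤ 0, g t = 0) ∧
  (∀ t, 1 ≤ t → g t = L) ∧ (∀ t, 0 ≤ g t ∧ g t ≤ L) ∧ CrookedOn ε g (Icc 0 1)

lemma qpath_base {ε L : ℝ} (h0 : 0 ≤ L) (hL : L < ε) : QPath ε L := by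
  have hc : Continuous fun t : ℝ => L * max 0 (min 1 t) := by fun_prop
  have hr : ∀ t : ℝ, 0 ≤ L * max 0 (min 1 t) ∧ L * max 0 (min 1 t) ≤ L := by
    intro t
    have h1 : (0 : ℝ) ≤ max 0 (min 1 t) := le_max_left _ _
    have h2 : max 0 (min 1 t) ≤ 1 := max_le zero_le_one (min_le_left _ _)
    exact ⟨mul_nonneg h0 h1, mul_le_of_le_one_right h0 h2⟩
  refine ⟨fun t => L * max 0 (min 1 t), hc, ?_, ?_, hr, ?_⟩
  · intro t ht
    simp [ht]
  · intro t ht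
    simp [ht]
  · intro a ha b hb hab
    refine crooked_close hc hab ?_
    have := hr a
    have := hr b
    rw [abs_lt]; constructor <;> linarith

lemma qpath_step {ε η L : ℝ} (hη : 0 < η) (hηε : 2 * η < ε)
    (h1 : QPath ε (L - η)) (h2 : QPath ε (L - 2 * η)) : QPath ε L := by
  obtain ⟨g, gc, g0, g1, gr, gk⟩ := h1
  obtain ⟨h, hc, h0, h1, hr, hk⟩ := h2
  set f : ℝ → ℝ := fun t => g t - h (t - 1) + g (t - 2) with hf
  have fc : Continuous f := by fun_prop
  have e1 : ∀ t ≤ 1, f t = g t := by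
    intro t ht
    simp only [hf]
    rw [h0 _ (by linarith), g0 (t - 2) (by linarith)]; ring
  have e2 : ∀ t, 1 ≤ t → t ≤ 2 → f t = (L - η) - h (1 * t + (-1)) := by
    intro t ht ht'
    simp only [hf]
    rw [g1 t ht, g0 (t - 2) (by linarith)]; ring_nf
  have e3 : ∀ t, 2 ≤ t → f t = η + g (1 * t + (-2)) := by
    intro t ht
    simp only [hf]
    rw [g1 t (by linarith), h1 (t - 1) (by linarith)]; ring_nf
  have key : CrookedOn ε f (Icc 0 3) := by
    refine crooked_step (k := L - η) hη hηε fc ?_ ?_ ?_ ?_ ?_ ?_ ?_ ?_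
    · exact crooked_congr gk fun x hx => e1 x hx.2
    · exact crooked_congr (crooked_const_sub (crooked_affine (α := 1) (β := -1) (p' := 0) (q' := 1) one_pos
        (by norm_num) (by norm_num) hk) (L - η)) fun x hx => e2 x hx.1 hx.2
    · exact crooked_congr (crooked_const_add (crooked_affine (α := 1) (β := -2) (p' := 0) (q' := 1) one_pos
        (by norm_num) (by norm_num) gk) η) fun x hx => e3 x hx.1
    · rw [e1 1 le_rfl, g1 1 le_rfl]
    · rw [e3 2 le_rfl, g0 _ (by norm_num)]; ring
    · intro t ht
      rw [e1 t ht.2]; exact gr t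
    · intro t ht
      rw [e2 t ht.1 ht.2]
      have := hr (1 * t + -1)
      constructor <;> linarith
    · intro t ht
      rw [e3 t ht.1]
      have := gr (1 * t + -2)
      constructor <;> linarith
  refine ⟨fun t => f (3 * t + 0), by fun_prop, ?_, ?_, ?_, ?_⟩
  · intro t ht
    simp only
    rw [e1 _ (by linarith), g0 _ (by linarith)]
  · intro t ht
    simp only
    rw [e3 _ (by linarith), g1 _ (by linarith)]; ring
  · intro t
    simp only
    rcases le_total (3 * t + 0) 1 with h | h
    · rw [e1 _ h]
      have := gr (3 * t + 0)
      constructor <;> linarith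
    rcases le_total (3 * t + 0) 2 with h' | h'
    · rw [e2 _ h h']
      have := hr (1 * (3 * t + 0) + -1)
      constructor <;> linarith
    · rw [e3 _ h']
      have := gr (1 * (3 * t + 0) + -2)
      constructor <;> linarith
  · exact crooked_affine (p' := 0) (q' := 3) (by norm_num) (by norm_num) (by norm_num) key

lemma qpath {ε : ℝ} (hε : 0 < ε) {L : ℝ} (hL : 0 ≤ L) : QPath ε L := by
  have main : ∀ n : ℕ, ∀ L : ℝ, 0 ≤ L → L ≤ (n + 2) * (ε / 3) → QPath ε L := by
    intro n
    induction n with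
    | zero =>
      intro L h0 h1
      refine qpath_base h0 ?_
      push_cast at h1
      linarith
    | succ n ih =>
      intro L h0 h1
      push_cast at h1
      by_cases h : L < ε
      · exact qpath_base h0 h
      · push Not at h
        refine qpath_step (η := ε / 3) (by linarith) (by linarith) (ih _ ?_ ?_)
          (ih _ ?_ ?_) <;> linarith
  obtain ⟨n, hn⟩ := exists_nat_ge (L / (ε / 3))
  refine main n L hL ?_
  rw [div_le_iff₀ (by linarith)] at hn
  linarith

lemma trig_approx {T : ℝ} (hT : 0 < T) {q₀ : ℝ → ℝ} (hq : Continuous q₀) (h0 : q₀ 0 = q₀ T)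
    {δ : ℝ} (hδ : 0 < δ) : ∃ q : ℝ → ℝ, AnalyticOnNhd ℝ q univ ∧ (∀ x, q (x + T) = q x) ∧
      ∀ x ∈ Icc 0 T, |q x - q₀ x| ≤ δ := by
  have : Fact (0 < T) := ⟨hT⟩
  have hc : Continuous (AddCircle.liftIco T 0 (fun x => (q₀ x : ℂ))) := by
    refine AddCircle.liftIco_continuous (by simp [h0]) ?_
    exact (Complex.continuous_ofReal.comp hq).continuousOn
  set F : C(AddCircle T, ℂ) := ⟨_, hc⟩ with hF
  have hF' : ∀ x ∈ Icc 0 T, F (x : AddCircle T) = q₀ x := by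
    intro x hx
    rcases hx.2.lt_or_eq with h | h
    · exact AddCircle.liftIco_zero_coe_apply (f := fun x => (q₀ x : ℂ)) ⟨hx.1, h⟩
    · have e : (x : AddCircle T) = ((0 : ℝ) : AddCircle T) := by
        rw [h]; simp
      rw [e, h, ← h0]
      exact AddCircle.liftIco_zero_coe_apply (f := fun x => (q₀ x : ℂ)) ⟨le_rfl, hT⟩
  have hmem : F ∈ (Submodule.span ℂ (range (@fourier T))).topologicalClosure := by
    rw [span_fourier_closure_eq_top]; trivial
  obtain ⟨G, hG, hGF⟩ := Metric.mem_closure_iff.1 hmem δ hδ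
  have hA : ∀ x : ℝ, AnalyticAt ℝ (fun y : ℝ => G (y : AddCircle T)) x := by
    clear hGF
    intro x
    refine Submodule.span_induction (p := fun G _ => AnalyticAt ℝ (fun y : ℝ => (G : C(AddCircle T, ℂ)) (y : AddCircle T)) x) ?_ ?_ ?_ ?_ hG
    · rintro _ ⟨n, rfl⟩
      simp only [fourier_coe_apply]
      have : AnalyticAt ℝ (fun y : ℝ => (y : ℂ)) x := Complex.ofRealCLM.analyticAt x
      have h2 : AnalyticAt ℝ (fun y : ℝ => 2 * (Real.pi : ℂ) * Complex.I * n * y / T) x := by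
        fun_prop
      exact (analyticAt_cexp.restrictScalars (𝕜 := ℝ)).comp h2
    · simpa using analyticAt_const
    · intro a b _ _ ha hb
      simpa using ha.fun_add hb
    · intro c a _ ha
      simpa using (analyticAt_const (v := c)).fun_mul ha
  refine ⟨fun x => (G (x : AddCircle T)).re, ?_, ?_, ?_⟩
  · intro x _
    exact (Complex.reCLM.analyticAt _).comp (hA x)
  · intro x; simp
  · intro x hx
    have h1 : ‖F (x : AddCircle T) - G (x : AddCircle T)‖ ≤ δ := by
      rw [← dist_eq_norm]
      exact (ContinuousMap.dist_apply_le_dist _).trans hGF.le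
    rw [hF' x hx] at h1
    have h2 := (Complex.abs_re_le_norm _).trans h1
    rw [abs_sub_comm]
    simpa using h2

lemma core_trig {y : ℝ} (h0 : 0 ≤ y) (h1 : y ≤ Real.pi / 2) :
    0 ≤ y - Real.sin (4 * y) / 4 ∧
      y - Real.sin (4 * y) / 4 ≤ (Real.pi + 1) * Real.sin y ^ 2 := by
  constructor
  · have := Real.sin_le (x := 4 * y) (by linarith)
    linarith
  have hs : 0 ≤ Real.sin y := Real.sin_nonneg_of_nonneg_of_le_pi h0 (by linarith [Real.pi_pos])
  have hc : 0 ≤ Real.cos y := Real.cos_nonneg_of_neg_pi_div_two_le_of_le (by linarith [Real.pi_pos]) h1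
  have key : 2 * y * Real.cos (2 * y) ≤ Real.sin (2 * y) := by
    have hs2 : 0 ≤ Real.sin (2 * y) := Real.sin_nonneg_of_nonneg_of_le_pi (by linarith) (by linarith)
    rcases lt_or_ge (2 * y) (Real.pi / 2) with h | h
    · have hcos : 0 < Real.cos (2 * y) :=
        Real.cos_pos_of_mem_Ioo ⟨by linarith [Real.pi_pos], h⟩
      have := Real.le_tan (x := 2 * y) (by linarith) h
      rwa [Real.tan_eq_sin_div_cos, le_div_iff₀ hcos] at this
    · have : Real.cos (2 * y) ≤ 0 :=
        Real.cos_nonpos_of_pi_div_two_le_of_le h (by linarith [Real.pi_pos])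
      have : 2 * y * Real.cos (2 * y) ≤ 0 := mul_nonpos_of_nonneg_of_nonpos (by linarith) this
      linarith
  have e4 : Real.sin (4 * y) = 2 * (2 * Real.sin y * Real.cos y) * (1 - 2 * Real.sin y ^ 2) := by
    rw [show 4 * y = 2 * (2 * y) by ring, Real.sin_two_mul, Real.sin_two_mul, Real.cos_two_mul,
      Real.cos_sq']
    ring
  rw [Real.cos_two_mul, Real.cos_sq', Real.sin_two_mul] at key
  have hsq : Real.sin y ^ 2 + Real.cos y ^ 2 = 1 := Real.sin_sq_add_cos_sq y
  have hsc : 2 * Real.sin y * Real.cos y ≤ 1 := by nlinarith [sq_nonneg (Real.sin y - Real.cos y)]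
  have h3 : Real.sin y ^ 2 * (2 * Real.sin y * Real.cos y) ≤ Real.sin y ^ 2 * 1 :=
    mul_le_mul_of_nonneg_left hsc (sq_nonneg _)
  have h4 : 2 * y * Real.sin y ^ 2 ≤ Real.pi * Real.sin y ^ 2 :=
    mul_le_mul_of_nonneg_right (by linarith) (sq_nonneg _)
  rw [e4]
  nlinarith

lemma core_bound {y M : ℝ} (hM : 1 ≤ M) (h0 : 0 ≤ y) (h1 : y ≤ Real.pi / 2) :
    1 / 24 * Real.sin (2 * y) ^ 2 ≤
      (2 - 1 / (2 * M)) * Real.sin y ^ 2 + (y - Real.sin (4 * y) / 4) / (Real.pi * M) ∧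
    1 / 24 * Real.sin (2 * y) ^ 2 ≤
      (2 - 1 / (2 * M)) * Real.sin y ^ 2 - (y - Real.sin (4 * y) / 4) / (Real.pi * M) := by
  obtain ⟨v0, v1⟩ := core_trig h0 h1
  set v := y - Real.sin (4 * y) / 4
  have hpi := Real.pi_gt_three
  have hs : 0 ≤ Real.sin y ^ 2 := sq_nonneg _
  have hv0 : 0 ≤ v / (Real.pi * M) := by positivity
  have hv1 : v / (Real.pi * M) ≤ 4 / 3 * Real.sin y ^ 2 := by
    rw [div_le_iff₀ (by positivity)]
    have a1 : Real.pi + 1 ≤ 4 / 3 * Real.pi := by linarith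
    have a2 : (4 / 3 * Real.pi) * 1 ≤ (4 / 3 * Real.pi) * M := by gcongr
    have a3 : (Real.pi + 1) * Real.sin y ^ 2 ≤ (4 / 3 * Real.pi * M) * Real.sin y ^ 2 := by
      apply mul_le_mul_of_nonneg_right _ hs; linarith
    linarith
  have hK : 3 / 2 ≤ 2 - 1 / (2 * M) := by
    have : 1 / (2 * M) ≤ 1 / 2 := by
      apply one_div_le_one_div_of_le <;> linarith
    linarith
  have hK' : 3 / 2 * Real.sin y ^ 2 ≤ (2 - 1 / (2 * M)) * Real.sin y ^ 2 :=
    mul_le_mul_of_nonneg_right hK hs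
  have hw : Real.sin (2 * y) ^ 2 ≤ 4 * Real.sin y ^ 2 := by
    rw [Real.sin_two_mul, mul_pow, mul_pow, Real.cos_sq']
    nlinarith
  constructor <;> linarith

noncomputable def EE (M x : ℝ) : ℝ :=
  x - Real.sin (4 * (Real.pi * M * x)) / 4 / (Real.pi * M) +
    (2 - 1 / (2 * M)) * Real.sin (Real.pi * M * x) ^ 2

noncomputable def WW (M x : ℝ) : ℝ := Real.sin (2 * (Real.pi * M * x)) ^ 2

lemma EE_bound1 {M x : ℝ} (hM : 1 ≤ M) (h0 : 0 ≤ x) (h1 : x ≤ 1 / (2 * M)) :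
    1 / 24 * WW M x ≤ EE M x ∧ EE M x ≤ 2 - 1 / 24 * WW M x := by
  have hpi := Real.pi_pos
  have hM0 : 0 < M := by linarith
  have hz0 : 0 ≤ Real.pi * M * x := by positivity
  have hz1 : Real.pi * M * x ≤ Real.pi / 2 := by
    rw [le_div_iff₀ (by positivity)] at h1
    nlinarith
  have hx : x = Real.pi * M * x / (Real.pi * M) := by field_simp
  have hx2 : 1 / (2 * M) = Real.pi / 2 / (Real.pi * M) := by field_simp
  unfold WW EE
  constructor
  · have := (core_bound hM hz0 hz1).1
    rw [sub_div, ← hx] at this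
    linarith
  · have := (core_bound (y := Real.pi / 2 - Real.pi * M * x) hM (by linarith) (by linarith)).1
    rw [show 2 * (Real.pi / 2 - Real.pi * M * x) = Real.pi - 2 * (Real.pi * M * x) by ring,
      show 4 * (Real.pi / 2 - Real.pi * M * x) = 2 * Real.pi - 4 * (Real.pi * M * x) by ring,
      Real.sin_pi_sub, Real.sin_two_pi_sub, Real.sin_pi_div_two_sub, Real.cos_sq', sub_div, sub_div,
      ← hx, ← hx2] at this
    linarith [neg_div 4 (Real.sin (4 * (Real.pi * M * x))), neg_div (Real.pi * M) (Real.sin (4 * (Real.pi * M * x)) / 4),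
      show -Real.sin (4 * (Real.pi * M * x)) / 4 / (Real.pi * M) = - (Real.sin (4 * (Real.pi * M * x)) / 4 / (Real.pi * M)) by ring]

lemma EE_bound2 {M x : ℝ} (hM : 1 ≤ M) (h0 : 1 / (2 * M) ≤ x) (h1 : x ≤ 1 / M) :
    1 / M + 1 / 24 * WW M x ≤ EE M x ∧ EE M x ≤ 2 - 1 / 24 * WW M x := by
  have hpi := Real.pi_pos
  have hM0 : 0 < M := by linarith
  have hz0 : Real.pi / 2 ≤ Real.pi * M * x := by
    rw [div_le_iff₀ (by positivity)] at h0
    nlinarith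
  have hz1 : Real.pi * M * x ≤ Real.pi := by
    rw [le_div_iff₀ (by positivity)] at h1
    nlinarith
  have hx : x = Real.pi * M * x / (Real.pi * M) := by field_simp
  have hx1 : 1 / M = Real.pi / (Real.pi * M) := by field_simp
  have hx2 : 1 / (2 * M) = Real.pi / 2 / (Real.pi * M) := by field_simp
  unfold WW EE
  constructor
  · have := (core_bound (y := Real.pi - Real.pi * M * x) hM (by linarith) (by linarith)).2
    rw [show 2 * (Real.pi - Real.pi * M * x) = 2 * Real.pi - 2 * (Real.pi * M * x) by ring,
      show 4 * (Real.pi - Real.pi * M * x) = (2 : ℕ) * (2 * Real.pi) - 4 * (Real.pi * M * x) by push_cast; ring,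
      Real.sin_pi_sub, Real.sin_two_pi_sub, Real.sin_nat_mul_two_pi_sub, sub_div, sub_div,
      ← hx, ← hx1, neg_sq] at this
    linarith [show -Real.sin (4 * (Real.pi * M * x)) / 4 / (Real.pi * M) = - (Real.sin (4 * (Real.pi * M * x)) / 4 / (Real.pi * M)) by ring]
  · have := (core_bound (y := Real.pi * M * x - Real.pi / 2) hM (by linarith) (by linarith)).2
    rw [show 2 * (Real.pi * M * x - Real.pi / 2) = 2 * (Real.pi * M * x) - Real.pi by ring,
      show 4 * (Real.pi * M * x - Real.pi / 2) = 4 * (Real.pi * M * x) - 2 * Real.pi by ring,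
      Real.sin_sub_pi, Real.sin_sub_two_pi, Real.sin_sub_pi_div_two, sub_div, sub_div,
      ← hx, ← hx2, neg_sq, neg_sq, Real.cos_sq'] at this
    linarith

lemma WW_zero {M x : ℝ} (hM : 1 ≤ M) (h0 : 0 ≤ x) (h1 : x ≤ 1 / M) (h : WW M x = 0) :
    x = 0 ∨ x = 1 / (2 * M) ∨ x = 1 / M := by
  have hpi := Real.pi_pos
  have hM0 : 0 < M := by linarith
  have h2 : Real.sin (2 * (Real.pi * M * x)) = 0 := by simpa [WW] using h
  obtain ⟨n, hn⟩ := Real.sin_eq_zero_iff.1 h2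
  have e : (n : ℝ) = 2 * M * x := by
    have : Real.pi * n = Real.pi * (2 * M * x) := by linarith
    exact mul_left_cancel₀ hpi.ne' this
  have n0 : (0 : ℝ) ≤ n := by rw [e]; positivity
  have n2 : (n : ℝ) ≤ 2 := by
    rw [le_div_iff₀ hM0] at h1
    rw [e]; nlinarith
  have n0' : 0 ≤ n := by exact_mod_cast n0
  have n2' : n ≤ 2 := by exact_mod_cast n2
  interval_cases n
  · left
    have : (2 * M) * x = 0 := by push_cast at e; linarith
    rcases mul_eq_zero.1 this with h | h
    · linarith
    · exact h
  · right; left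
    rw [eq_div_iff (by positivity)]; push_cast at e; linarith
  · right; right
    rw [eq_div_iff (by positivity)]; push_cast at e; linarith

lemma comb {w κ δ δ' l E f D : ℝ} (w0 : 0 ≤ w) (w1 : w ≤ 1) (hκ : 0 < κ) (hD : |D| ≤ δ')
    (hδ : δ' * (1 + κ) ≤ κ * δ) (hf : l ≤ f) (hE : l + δ * w ≤ E) :
    l ≤ E + w * ((f - E) / (w + κ) + D) := by
  have hwk : 0 < w + κ := by linarith
  have hD' := (abs_le.1 hD).1
  have hδ0 : 0 ≤ δ' := (abs_nonneg _).trans hD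
  have e : (w + κ) * (E + w * ((f - E) / (w + κ) + D) - l) =
      κ * (E - l) + w * (f - l) + w * ((w + κ) * D) := by field_simp; ring
  have a1 : κ * (δ * w) ≤ κ * (E - l) := by gcongr; linarith
  have a2 : 0 ≤ w * (f - l) := mul_nonneg w0 (by linarith)
  have a3 : (w + κ) * (-δ') ≤ (w + κ) * D := by gcongr
  have a4 : (w + κ) * δ' ≤ (1 + κ) * δ' := by gcongr
  have a5 : w * (-(κ * δ)) ≤ w * ((w + κ) * D) := by
    apply mul_le_mul_of_nonneg_left _ w0; linarith
  have : 0 ≤ (w + κ) * (E + w * ((f - E) / (w + κ) + D) - l) := by rw [e]; linarith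
  have := nonneg_of_mul_nonneg_right this hwk
  linarith

lemma comb' {w κ δ δ' l E f D : ℝ} (w0 : 0 ≤ w) (w1 : w ≤ 1) (hκ : 0 < κ) (hD : |D| ≤ δ')
    (hδ : δ' * (1 + κ) ≤ κ * δ) (hf : f ≤ l) (hE : E ≤ l - δ * w) :
    E + w * ((f - E) / (w + κ) + D) ≤ l := by
  have := comb (l := -l) (E := -E) (f := -f) (D := -D) w0 w1 hκ (by simpa using hD) hδ
    (by linarith) (by linarith)
  have e : -E + w * ((-f - -E) / (w + κ) + -D) = -(E + w * ((f - E) / (w + κ) + D)) := by ring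
  linarith

lemma comb_close {w κ δ' η E f D : ℝ} (w0 : 0 ≤ w) (w1 : w ≤ 1) (hκ : 0 < κ) (hD : |D| ≤ δ')
    (h : κ * |E - f| ≤ η * (w + κ)) :
    |E + w * ((f - E) / (w + κ) + D) - f| ≤ η + δ' := by
  have hwk : 0 < w + κ := by linarith
  have e : E + w * ((f - E) / (w + κ) + D) - f = κ * (E - f) / (w + κ) + w * D := by
    field_simp; ring
  rw [e]
  refine (abs_add_le _ _).trans ?_
  rw [abs_div, abs_mul, abs_mul, abs_of_pos hκ, abs_of_pos hwk, abs_of_nonneg w0]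
  have h1 : κ * |E - f| / (w + κ) ≤ η := by rwa [div_le_iff₀ hwk]
  have h2 : w * |D| ≤ 1 * |D| := by gcongr
  linarith

lemma exists_kappa {h w : ℝ → ℝ} (hh : Continuous h) (hw : Continuous w) {p q : ℝ}
    (w0 : ∀ x, 0 ≤ w x) (hz : ∀ x ∈ Icc p q, w x = 0 → h x = 0) {η : ℝ} (hη : 0 < η) :
    ∃ κ, 0 < κ ∧ ∀ x ∈ Icc p q, κ * |h x| ≤ η * (w x + κ) := by
  set K := Icc p q ∩ {x | η ≤ |h x|} with hK
  have hKc : IsCompact K := isCompact_Icc.inter_right (isClosed_le continuous_const hh.abs)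
  rcases K.eq_empty_or_nonempty with he | hne
  · refine ⟨1, one_pos, fun x hx => ?_⟩
    have : |h x| < η := by
      by_contra hcon
      have : x ∈ K := ⟨hx, not_lt.1 hcon⟩
      rw [he] at this; exact this
    nlinarith [w0 x]
  · obtain ⟨x0, hx0, hmin⟩ := hKc.exists_isMinOn hne hw.continuousOn
    have hpos : 0 < w x0 := by
      refine lt_of_le_of_ne (w0 x0) fun hcon => ?_
      have := hz x0 hx0.1 hcon.symm
      have h2 : η ≤ |h x0| := hx0.2
      rw [this, abs_zero] at h2
      linarith
    obtain ⟨C, hC⟩ := isCompact_Icc.exists_bound_of_continuousOn (s := Icc p q) hh.continuousOn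
    have hC1 : 0 < |C| + 1 := by positivity
    refine ⟨η * w x0 / (|C| + 1), by positivity, fun x hx => ?_⟩
    have hκ : 0 < η * w x0 / (|C| + 1) := by positivity
    by_cases hxK : η ≤ |h x|
    · have h1 : w x0 ≤ w x := hmin ⟨hx, hxK⟩
      have h2 : |h x| ≤ |C| + 1 := by
        have := hC x hx
        rw [Real.norm_eq_abs] at this
        linarith [le_abs_self C]
      calc η * w x0 / (|C| + 1) * |h x| ≤ η * w x0 / (|C| + 1) * (|C| + 1) := by gcongr
        _ = η * w x0 := by field_simp
        _ ≤ η * (w x + η * w x0 / (|C| + 1)) := by gcongr; linarith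
    · push Not at hxK
      have := w0 x
      calc η * w x0 / (|C| + 1) * |h x| ≤ η * w x0 / (|C| + 1) * η := by gcongr
        _ = η * (0 + η * w x0 / (|C| + 1)) := by ring
        _ ≤ _ := by gcongr

theorem exists_analytic_crooked_lift (ε : ℝ) (hε : 0 < ε) (m : ℕ) (hm : 0 < m) :
    ∃ θ : ℝ → ℝ, AnalyticOnNhd ℝ θ Set.univ ∧
      (∀ x : ℝ, θ (x + 1 / m) - (x + 1 / m) = θ x - x) ∧
      θ 0 = 0 ∧ θ (1 / (2 * m)) = 2 ∧
      θ '' Set.Icc 0 (1 / (2 * m)) = Set.Icc 0 2 ∧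
      CrookedOn ε θ (Set.Icc 0 (1 / (2 * m))) ∧
      θ (1 / m) = 1 / m ∧
      θ '' Set.Icc (1 / (2 * m)) (1 / m) = Set.Icc (1 / (m : ℝ)) 2 ∧
      CrookedOn ε θ (Set.Icc (1 / (2 * m)) (1 / m)) := by
  have hM : (1 : ℝ) ≤ m := by exact_mod_cast hm
  generalize (m : ℝ) = M at hM ⊢
  have hM0 : 0 < M := by linarith
  have hpi := Real.pi_pos
  have hT : 0 < 1 / M := by positivity
  have hT1 : 1 / M ≤ 1 := by rw [div_le_one hM0]; exact hM
  have hT2 : 0 < 1 / (2 * M) := by positivity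
  have hT2' : 1 / (2 * M) < 1 / M := one_div_lt_one_div_of_lt hM0 (by linarith)
  -- the crooked continuous model
  obtain ⟨g, gc, g0, g1, gr, gk⟩ := qpath (ε := ε / 2) (by linarith) (L := 2) (by norm_num)
  obtain ⟨h, hc, h0, h1, hr, hk⟩ := qpath (ε := ε / 2) (by linarith) (L := 2 - 1 / M) (by linarith)
  set f : ℝ → ℝ := fun x => g (2 * M * x + 0) - h (2 * M * x + (-1)) with hf
  have fc : Continuous f := by fun_prop
  have s1 : ∀ x, x ≤ 1 / (2 * M) → 2 * M * x ≤ 1 := by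
    intro x hx
    rw [le_div_iff₀ (by positivity)] at hx
    linarith
  have s2 : ∀ x, 1 / (2 * M) ≤ x → 1 ≤ 2 * M * x := by
    intro x hx
    rw [div_le_iff₀ (by positivity)] at hx
    linarith
  have fe1 : ∀ x ∈ Icc 0 (1 / (2 * M)), f x = g (2 * M * x + 0) := by
    intro x hx
    simp only [hf]
    rw [h0 _ (by linarith [s1 x hx.2])]; ring
  have fe2 : ∀ x ∈ Icc (1 / (2 * M)) (1 / M), f x = 2 - h (2 * M * x + (-1)) := by
    intro x hx
    simp only [hf]
    rw [g1 _ (by linarith [s2 x hx.1])]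
  have fk1 : CrookedOn (ε / 2) f (Icc 0 (1 / (2 * M))) :=
    crooked_congr (crooked_affine (α := 2 * M) (β := 0) (by positivity) (by ring) (by field_simp; ring) gk) fe1
  have fk2 : CrookedOn (ε / 2) f (Icc (1 / (2 * M)) (1 / M)) :=
    crooked_congr (crooked_const_sub (crooked_affine (α := 2 * M) (β := -1) (by positivity)
      (by field_simp; ring) (by field_simp; ring) hk) 2) fe2
  have fr1 : ∀ x ∈ Icc 0 (1 / (2 * M)), 0 ≤ f x ∧ f x ≤ 2 := by
    intro x hx
    rw [fe1 x hx]; exact gr _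
  have fr2 : ∀ x ∈ Icc (1 / (2 * M)) (1 / M), 1 / M ≤ f x ∧ f x ≤ 2 := by
    intro x hx
    rw [fe2 x hx]
    have := hr (2 * M * x + -1)
    constructor <;> linarith
  have f0 : f 0 = 0 := by
    rw [fe1 0 ⟨le_rfl, hT2.le⟩]; exact g0 _ (by norm_num)
  have fh : f (1 / (2 * M)) = 2 := by
    rw [fe1 _ ⟨hT2.le, le_rfl⟩]; exact g1 _ (by field_simp; norm_num)
  have fT : f (1 / M) = 1 / M := by
    rw [fe2 _ ⟨hT2'.le, le_rfl⟩, h1 _ (by field_simp; norm_num)]; ring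
  -- the analytic base function
  have E0 : EE M 0 = 0 := by simp [EE]
  have Eh : EE M (1 / (2 * M)) = 2 := by
    have : Real.pi * M * (1 / (2 * M)) = Real.pi / 2 := by field_simp
    unfold EE
    rw [this, show 4 * (Real.pi / 2) = 2 * Real.pi by ring, Real.sin_two_pi, Real.sin_pi_div_two]
    ring
  have Eper : ∀ x, EE M (x + 1 / M) = EE M x + 1 / M := by
    intro x
    have : Real.pi * M * (x + 1 / M) = Real.pi * M * x + Real.pi := by field_simp
    unfold EE
    rw [this, Real.sin_add_pi, show 4 * (Real.pi * M * x + Real.pi) =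
      4 * (Real.pi * M * x) + (2 : ℕ) * (2 * Real.pi) by push_cast; ring,
      Real.sin_add_nat_mul_two_pi]
    ring
  have ET : EE M (1 / M) = 1 / M := by
    have := Eper 0
    rw [E0] at this; simpa using this
  have Wper : ∀ x, WW M (x + 1 / M) = WW M x := by
    intro x
    have : 2 * (Real.pi * M * (x + 1 / M)) = 2 * (Real.pi * M * x) + 2 * Real.pi := by
      field_simp
    unfold WW
    rw [this, Real.sin_add_two_pi]
  have W0 : WW M 0 = 0 := by simp [WW]
  have WT : WW M (1 / M) = 0 := by
    have := Wper 0
    rw [W0] at this; simpa using this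
  have Wh : WW M (1 / (2 * M)) = 0 := by
    have : 2 * (Real.pi * M * (1 / (2 * M))) = Real.pi := by field_simp
    unfold WW
    rw [this]; simp
  have w0 : ∀ x, 0 ≤ WW M x := fun x => sq_nonneg _
  have w1 : ∀ x, WW M x ≤ 1 := fun x => Real.sin_sq_le_one _
  have Ea : AnalyticOnNhd ℝ (EE M) univ := by
    intro x _
    unfold EE
    fun_prop
  have Wa : AnalyticOnNhd ℝ (WW M) univ := by
    intro x _
    unfold WW
    fun_prop
  have Ec : Continuous (EE M) := by unfold EE; fun_prop
  have Wc : Continuous (WW M) := by unfold WW; fun_prop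
  obtain ⟨κ, hκ, hκ'⟩ := exists_kappa (h := fun x => EE M x - f x) (w := WW M) (p := 0)
    (q := 1 / M) (by fun_prop) Wc w0 (by
      intro x hx hw
      rcases WW_zero hM hx.1 hx.2 hw with h | h | h
      · simp only [h, E0, f0, sub_self]
      · rw [h]; simp only [Eh, fh, sub_self]
      · rw [h]; simp only [ET, fT, sub_self]) (η := ε / 8) (by linarith)
  obtain ⟨δ, hδ, hδ1, hδ2⟩ : ∃ δ, 0 < δ ∧ δ * (1 + κ) ≤ κ * (1 / 24) ∧ δ ≤ ε / 8 := by
    refine ⟨min (κ * (1 / 24) / (1 + κ)) (ε / 8), by positivity, ?_, min_le_right _ _⟩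
    rw [← le_div_iff₀ (by positivity)]
    exact min_le_left _ _
  have wk : ∀ x, WW M x + κ ≠ 0 := fun x => by
    have := w0 x
    positivity
  obtain ⟨q, qa, qp, qd⟩ := trig_approx hT (q₀ := fun x => (f x - EE M x) / (WW M x + κ))
    (Continuous.div (by fun_prop) (by fun_prop) wk) (by simp [f0, E0, W0, -one_div, fT, ET]) hδ
  set θ : ℝ → ℝ := fun x => EE M x + WW M x * q x with hθ
  have θe : ∀ x, θ x = EE M x + WW M x * ((f x - EE M x) / (WW M x + κ) +
      (q x - (f x - EE M x) / (WW M x + κ))) := by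
    intro x; simp only [hθ]; ring
  have θa : AnalyticOnNhd ℝ θ univ :=
    fun x hx => (Ea x hx).fun_add ((Wa x hx).fun_mul (qa x hx))
  have θc : Continuous θ := by
    rw [← continuousOn_univ]; exact θa.continuousOn
  have θ0 : θ 0 = 0 := by simp [hθ, E0, W0]
  have θh : θ (1 / (2 * M)) = 2 := by simp only [hθ, Eh, Wh]; ring
  have θT : θ (1 / M) = 1 / M := by simp only [hθ, ET, WT]; ring
  have close : ∀ x ∈ Icc 0 (1 / M), |θ x - f x| ≤ ε / 4 := by
    intro x hx
    rw [θe]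
    have := comb_close (w0 x) (w1 x) hκ (qd x hx) (hκ' x hx)
    linarith
  refine ⟨θ, θa, ?_, θ0, θh, ?_, ?_, θT, ?_, ?_⟩
  · intro x
    simp only [hθ, Eper, Wper, qp]; ring
  · apply Subset.antisymm
    · rintro _ ⟨x, hx, rfl⟩
      have hx' : x ∈ Icc 0 (1 / M) := ⟨hx.1, hx.2.trans hT2'.le⟩
      have hE := EE_bound1 hM hx.1 hx.2
      have hF := fr1 x hx
      rw [θe]
      exact ⟨comb (w0 x) (w1 x) hκ (qd x hx') hδ1 hF.1 (by linarith),
        comb' (w0 x) (w1 x) hκ (qd x hx') hδ1 hF.2 (by linarith)⟩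
    · have := intermediate_value_Icc hT2.le θc.continuousOn
      rwa [θ0, θh] at this
  · have := crooked_approx (f := θ) (ρ := ε / 4) fk1
      (fun x hx => close x ⟨hx.1, hx.2.trans hT2'.le⟩)
    rwa [show ε / 2 + 2 * (ε / 4) = ε by ring] at this
  · apply Subset.antisymm
    · rintro _ ⟨x, hx, rfl⟩
      have hx' : x ∈ Icc 0 (1 / M) := ⟨hT2.le.trans hx.1, hx.2⟩
      have hE := EE_bound2 hM hx.1 hx.2
      have hF := fr2 x hx
      rw [θe]
      exact ⟨comb (w0 x) (w1 x) hκ (qd x hx') hδ1 hF.1 (by linarith),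
        comb' (w0 x) (w1 x) hκ (qd x hx') hδ1 hF.2 (by linarith)⟩
    · have := intermediate_value_Icc' hT2'.le θc.continuousOn
      rwa [θT, θh] at this
  · have := crooked_approx (f := θ) (ρ := ε / 4) fk2
      (fun x hx => close x ⟨hT2.le.trans hx.1, hx.2⟩)
    rwa [show ε / 2 + 2 * (ε / 4) = ε by ring] at this
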